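/- In the abstract Nitsche setting, assume the generalized Cauchy–Schwarz inequality holds on W for some γ ≥ 1. Then the Nitsche bilinear form is bounded with respect to the energy norm: |a_h(w, v)| ≤ 3 · |||w||| · |||v||| for all w, v ∈ W. -/

import Mathlib

/-- Cauchy–Schwarz for a symmetric positive-semidefinite bilinear form. -/
theorem abs_bilin_le_sqrt_mul_sqrt {E : Type*} [AddCommGroup E] [Module ℝ E]
    (b : E →ₗ[ℝ] E →ₗ[ℝ] ℝ) (hsymm : ∀ x y, b x y = b y x) (hpsd : ∀ x, 0 ≤ b x x) (x y : E) :
    |b x y| ≤ √(b x x) * √(b y y) := by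
  rw [← Real.sqrt_mul (hpsd x)]
  exact Real.abs_le_sqrt (LinearMap.BilinForm.apply_sq_le_of_symm b hpsd ⟨fun u v => hsymm u v⟩ x y)

/-- A four-term Cauchy–Schwarz inequality in which the roles of the second and third entries
are exchanged. -/
theorem cross_sum_le_sqrt_mul_sqrt (x y z x' y' z' : ℝ) :
    x * x' + y * z' + y' * z + z * z' ≤
      √(x ^ 2 + y ^ 2 + 2 * z ^ 2) * √(x' ^ 2 + y' ^ 2 + 2 * z' ^ 2) := by
  rw [← Real.sqrt_mul (by positivity)]
  apply Real.le_sqrt_of_sq_le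
  nlinarith [sq_nonneg (x * z' - y * x'), sq_nonneg (x * y' - z * x'), sq_nonneg (x * z' - z * x'),
    sq_nonneg (y * y' - z * z'), sq_nonneg (y * z' - z * z'), sq_nonneg (z * z' - z * y')]

/-- Boundedness of the Nitsche bilinear form with respect to the energy norm:
under the generalized Cauchy–Schwarz inequality with constant `γ ≥ 1`,
`|a_h(w,v)| ≤ 3·|||w|||·|||v|||` for all `w, v ∈ W`. -/
theorem stmt_7 {V Q : Type*} [NormedAddCommGroup V] [InnerProductSpace ℝ V] [CompleteSpace V]
    [NormedAddCommGroup Q] [InnerProductSpace ℝ Q] [CompleteSpace Q]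
    (T : V →L[ℝ] Q) (W : Submodule ℝ V)
    (a : V →ₗ[ℝ] V →ₗ[ℝ] ℝ)
    (hasymm : ∀ w v : V, a w v = a v w) (hapsd : ∀ v : V, 0 ≤ a v v)
    (B : W →ₗ[ℝ] Q →L[ℝ] ℝ)
    (n : W →ₗ[ℝ] W →ₗ[ℝ] ℝ)
    (hnsymm : ∀ w v : W, n w v = n v w) (hnpsd : ∀ v : W, 0 ≤ n v v)
    (p : Q →ₗ[ℝ] Q →ₗ[ℝ] ℝ)
    (hpsymm : ∀ q r : Q, p q r = p r q) (hppsd : ∀ q : Q, 0 ≤ p q q)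
    (ah : W → W → ℝ)
    (hah : ∀ w v : W, ah w v =
      a (w : V) (v : V) - B w (T (v : V)) - B v (T (w : V)) + p (T (w : V)) (T (v : V)))
    (Enorm : W → ℝ)
    (hEnorm : ∀ v : W, Enorm v =
      Real.sqrt (a (v : V) (v : V) + n v v + 2 * p (T (v : V)) (T (v : V))))
    (γ : ℝ) (hγ : 1 ≤ γ)
    (hCS : ∀ v w : W, |B v (T (w : V))| ≤
      (1 / γ) * Real.sqrt (n v v) * Real.sqrt (p (T (w : V)) (T (w : V)))) :
    ∀ w v : W, |ah w v| ≤ 3 * Enorm w * Enorm v := by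
  intro w v
  have hB : ∀ v w : W, |B v (T (w : V))| ≤ √(n v v) * √(p (T (w : V)) (T (w : V))) := by
    intro v w
    refine (hCS v w).trans ?_
    rw [mul_assoc]
    exact mul_le_of_le_one_left (by positivity) (div_le_one_of_le₀ hγ (by positivity))
  have ha := abs_bilin_le_sqrt_mul_sqrt a hasymm hapsd (w : V) (v : V)
  have hp := abs_bilin_le_sqrt_mul_sqrt p hpsymm hppsd (T (w : V)) (T (v : V))
  have hE := cross_sum_le_sqrt_mul_sqrt
    √(a (w : V) (w : V)) √(n w w) √(p (T (w : V)) (T (w : V)))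
    √(a (v : V) (v : V)) √(n v v) √(p (T (v : V)) (T (v : V)))
  simp only [Real.sq_sqrt (hapsd _), Real.sq_sqrt (hnpsd _), Real.sq_sqrt (hppsd _),
    ← hEnorm] at hE
  have hE0 : 0 ≤ Enorm w * Enorm v := by
    rw [hEnorm, hEnorm]
    positivity
  have h₁ := abs_le.mp (hB w v)
  have h₂ := abs_le.mp (hB v w)
  rw [abs_le] at ha hp
  rw [hah, abs_le]
  constructor <;> linarith
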